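/- Let (R,𝔪) be a Cohen-Macaulay local ring with canonical module that is generically Gorenstein, and let ω be a canonical ideal of R. Then exactly one of the following holds: (1) R ⊕ X_{ω/ω²} ≅ X_{R/ω²} and ω ⊕ Y_{ω/ω²} ≅ Y_{R/ω²}; (2) R ⊕ X_{ω/ω²} ≅ ω ⊕ X_{R/ω²} and Y_{ω/ω²} ≅ Y_{R/ω²}. Here 0 → Y_M → X_M → M → 0 denotes the minimal MCM approximation of M. -/

import Mathlib

open CategoryTheory

noncomputable section

/-- The Ext module `Ext^n_R(M, N)` for `R`-modules `M`, `N`. -/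
abbrev ModExt (R : Type) [CommRing R] (n : ℕ) (M N : ModuleCat R) : ModuleCat R :=
  ((Ext R (ModuleCat R) n).obj (Opposite.op M)).obj N

/-- An `R`-module `M` has finite injective dimension if `Ext^i_R(-, M)` vanishes
for all `i` beyond some bound. -/
def HasFiniteInjDim (R : Type) [CommRing R] (M : ModuleCat R) : Prop :=
  ∃ n : ℕ, ∀ (N : ModuleCat R) (i : ℕ), n < i → Subsingleton (ModExt R i N M)

/-- The depth of a module over a local ring, via Rees' characterization:
the least `n` with `Ext^n(k, M) ≠ 0`. -/
def moduleDepth (R : Type) [CommRing R] [IsLocalRing R] (M : ModuleCat R) : ℕ∞ :=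
  sInf {n : ℕ∞ | ∃ m : ℕ, n = (m : ℕ∞) ∧
    Nontrivial (ModExt R m (ModuleCat.of R (IsLocalRing.ResidueField R)) M)}

/-- A Noetherian local ring is Cohen-Macaulay if its depth equals its Krull dimension. -/
def IsCMLocalRing (R : Type) [CommRing R] [IsLocalRing R] : Prop :=
  IsNoetherianRing R ∧
    (moduleDepth R (ModuleCat.of R R) : WithBot ℕ∞) = ringKrullDim R

/-- A maximal Cohen-Macaulay module: finitely generated with depth equal to `dim R`. -/
def IsMCM (R : Type) [CommRing R] [IsLocalRing R] (X : ModuleCat R) : Prop :=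
  Module.Finite R X ∧ (moduleDepth R X : WithBot ℕ∞) = ringKrullDim R

/-- A Cohen-Macaulay module of codimension one:
`depth M = dim M = dim R - 1`. -/
def IsCMofCodimOne (R : Type) [CommRing R] [IsLocalRing R] (M : ModuleCat R) : Prop :=
  Module.Finite R M ∧ ∃ d : ℕ, ringKrullDim R = ((d + 1 : ℕ) : WithBot ℕ∞) ∧
    moduleDepth R M = (d : ℕ∞) ∧
    ringKrullDim (R ⧸ Module.annihilator R M) = ((d : ℕ) : WithBot ℕ∞)

/-- A Gorenstein local ring: Noetherian local with finite injective dimension over itself. -/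
def IsGorensteinLocalRing (A : Type) [CommRing A] : Prop :=
  IsNoetherianRing A ∧ IsLocalRing A ∧ HasFiniteInjDim A (ModuleCat.of A A)

/-- `R` is generically Gorenstein if its localization at every minimal prime is Gorenstein. -/
def IsGenericallyGorenstein (R : Type) [CommRing R] : Prop :=
  ∀ p ∈ minimalPrimes R, ∀ h : p.IsPrime,
    letI := h
    IsGorensteinLocalRing (Localization.AtPrime p)

/-- A canonical module of a local ring `R`: finitely generated, of finite injective
dimension, with `Ext^i(k, ω) ≅ k` for `i = dim R` and `Ext^i(k, ω) = 0` otherwise. -/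
def IsCanonicalModule (R : Type) [CommRing R] [IsLocalRing R] (W : ModuleCat R) : Prop :=
  Module.Finite R W ∧ HasFiniteInjDim R W ∧
    ∃ d : ℕ, ringKrullDim R = (d : ℕ) ∧
      Nonempty ((ModExt R d (ModuleCat.of R (IsLocalRing.ResidueField R)) W) ≃ₗ[R]
        IsLocalRing.ResidueField R) ∧
      ∀ i : ℕ, i ≠ d →
        Subsingleton (ModExt R i (ModuleCat.of R (IsLocalRing.ResidueField R)) W)

/-- A canonical ideal: an ideal of `R` which, as an `R`-module, is a canonical module. -/
def IsCanonicalIdeal (R : Type) [CommRing R] [IsLocalRing R] (I : Ideal R) : Prop :=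
  IsCanonicalModule R (ModuleCat.of R I)

/-- `Y` and `X` have a common nonzero direct summand via the map `ι : Y → X`. -/
def HasCommonSummandVia (R : Type) [CommRing R] {Y X : ModuleCat R}
    (ι : Y →ₗ[R] X) : Prop :=
  ∃ (N Y' X' : ModuleCat.{0} R), Nontrivial N ∧
    ∃ (e : Y ≃ₗ[R] N × Y') (f : X ≃ₗ[R] N × X') (ι' : Y' →ₗ[R] X'),
      ∀ y : Y, f (ι y) = ((e y).1, ι' (e y).2)

/-- `0 → Y → X → M → 0` is an MCM approximation of `M`. -/
def IsMCMApprox (R : Type) [CommRing R] [IsLocalRing R] (M Y X : ModuleCat R)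
    (ι : Y →ₗ[R] X) (π : X →ₗ[R] M) : Prop :=
  Module.Finite R M ∧ Module.Finite R Y ∧ IsMCM R X ∧ HasFiniteInjDim R Y ∧
    Function.Injective ι ∧ Function.Surjective π ∧ Function.Exact ι π

/-- `0 → Y → X → M → 0` is a minimal MCM approximation of `M`. -/
def IsMinMCMApprox (R : Type) [CommRing R] [IsLocalRing R] (M Y X : ModuleCat R)
    (ι : Y →ₗ[R] X) (π : X →ₗ[R] M) : Prop :=
  IsMCMApprox R M Y X ι π ∧ ¬ HasCommonSummandVia R ι

/-- `0 → M → Y → X → 0` is an FID hull of `M`. -/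
def IsFIDHull (R : Type) [CommRing R] [IsLocalRing R] (M Y X : ModuleCat R)
    (ι : M →ₗ[R] Y) (π : Y →ₗ[R] X) : Prop :=
  Module.Finite R M ∧ Module.Finite R Y ∧ HasFiniteInjDim R Y ∧
    (IsMCM R X ∨ Subsingleton X) ∧
    Function.Injective ι ∧ Function.Surjective π ∧ Function.Exact ι π

/-- `0 → M → Y → X → 0` is a minimal FID hull of `M`. -/
def IsMinFIDHull (R : Type) [CommRing R] [IsLocalRing R] (M Y X : ModuleCat R)
    (ι : M →ₗ[R] Y) (π : Y →ₗ[R] X) : Prop :=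
  IsFIDHull R M Y X ι π ∧ ¬ HasCommonSummandVia R π

/-- The free rank of a module: the largest `m` with `R^m` a direct summand. -/
def freeRank (R : Type) [CommRing R] (X : ModuleCat R) : ℕ∞ :=
  sSup {n : ℕ∞ | ∃ m : ℕ, n = (m : ℕ∞) ∧
    ∃ X' : ModuleCat.{0} R, Nonempty (X ≃ₗ[R] ((Fin m → R) × X'))}

/-- The `W`-rank of a module: the largest `m` with `W^m` a direct summand. -/
def wRank (R : Type) [CommRing R] (W X : ModuleCat R) : ℕ∞ :=
  sSup {n : ℕ∞ | ∃ m : ℕ, n = (m : ℕ∞) ∧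
    ∃ X' : ModuleCat.{0} R, Nonempty (X ≃ₗ[R] ((Fin m → W) × X'))}

/-- `M` and `N` are `W`-stably isomorphic. -/
def WStablyIso (R : Type) [CommRing R] (W M N : ModuleCat R) : Prop :=
  ∃ s t : ℕ, Nonempty ((M × (Fin s → W)) ≃ₗ[R] (N × (Fin t → W)))

/-- The quotient module `I/J` (realized as `I` modulo the elements of `J` lying in `I`). -/
abbrev qmod (R : Type) [CommRing R] (I J : Ideal R) : ModuleCat R :=
  ModuleCat.of R (I ⧸ (Submodule.comap I.subtype J))


open Limits in
lemma CategoryTheory.ProjectiveResolution.extMk_zero_eq_zero_iff {C : Type*} [Category C] [Abelian C] [HasExt C]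
    {X Y : C} (P : ProjectiveResolution X) (f : P.complex.X 0 ⟶ Y)
    (hf : P.complex.d 1 0 ≫ f = 0) : P.extMk f 1 rfl hf = 0 ↔ f = 0 := by
  refine ⟨fun h => ?_, fun h => by subst h; simp⟩
  rw [← P.extEquivCohomologyClass.apply_eq_iff_eq, extEquivCohomologyClass_extMk,
    extEquivCohomologyClass_zero, CochainComplex.HomComplex.CohomologyClass.mk_eq_zero_iff,
    CochainComplex.HomComplex.Cocycle.toSingleMk_mem_coboundaries_iff _ _ _ _ _ 1 (by lia)] at h
  obtain ⟨g, hg⟩ := h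
  rw [← cancel_epi (P.cochainComplexXIso (-(0 : ℕ)) 0 rfl).hom, ← hg]
  have : IsZero (P.cochainComplex.X 1) := by
    exact P.cochainComplex.isZero_of_isStrictlyLE 0 1
  rw [this.eq_of_src g 0]
  simp

section comparison

variable {R : Type} [CommRing R] {M N : ModuleCat R} (P : ProjectiveResolution M) (n : ℕ)

/-- The morphism `P_n ⟶ N` underlying an `n`-cocycle of `Hom(P, N)`. -/
def cocycleHom (f : LinearMap.ker ((P.complex.linearYonedaObj R N).sc n).g.hom) :
    P.complex.X n ⟶ N := f.1

lemma d_comp_cocycleHom (f : LinearMap.ker ((P.complex.linearYonedaObj R N).sc n).g.hom) :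
    P.complex.d (n + 1) n ≫ cocycleHom P n f = 0 := by
  obtain ⟨f, hf⟩ := f
  rw [LinearMap.mem_ker] at hf
  change ((P.complex.linearYonedaObj R N).d n _).hom f = 0 at hf
  rw [CochainComplex.next] at hf
  exact hf

/-- The linear map from `n`-cocycles of `Hom(P, N)` to `Ext`. -/
def cocycleToExt :
    LinearMap.ker ((P.complex.linearYonedaObj R N).sc n).g.hom →ₗ[R] Abelian.Ext M N n where
  toFun f := P.extMk (cocycleHom P n f) (n + 1) rfl (d_comp_cocycleHom P n f)
  map_add' f g := (P.add_extMk _ _ _ _ _ _).symm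
  map_smul' r f := by
    rw [RingHom.id_apply, Abelian.Ext.smul_eq_comp_mk₀, P.extMk_comp_mk₀]
    congr 1

lemma cocycleToExt_surjective : Function.Surjective (cocycleToExt P n (N := N)) := by
  intro α
  obtain ⟨f, hf, rfl⟩ := P.extMk_surjective α (n + 1) rfl
  refine ⟨⟨f, ?_⟩, rfl⟩
  change ((P.complex.linearYonedaObj R N).d n _).hom f = 0
  rw [CochainComplex.next]
  exact hf

lemma ker_cocycleToExt : LinearMap.ker (cocycleToExt P n (N := N)) =
    LinearMap.range ((P.complex.linearYonedaObj R N).sc n).moduleCatToCycles := by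
  ext f
  rw [LinearMap.mem_ker, LinearMap.mem_range]
  change P.extMk (cocycleHom P n f) (n + 1) rfl (d_comp_cocycleHom P n f) = 0 ↔ _
  have key : ∀ g : ((P.complex.linearYonedaObj R N).sc n).X₁,
      ((P.complex.linearYonedaObj R N).sc n).moduleCatToCycles g = f ↔
      ((P.complex.linearYonedaObj R N).d _ n).hom g = cocycleHom P n f :=
    fun g => Subtype.ext_iff
  simp_rw [key]
  cases n with
  | zero =>
    rw [P.extMk_zero_eq_zero_iff]
    change _ ↔ ∃ g, ((P.complex.linearYonedaObj R N).d _ 0).hom g = _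
    rw [CochainComplex.prev_nat_zero, (P.complex.linearYonedaObj R N).shape _ _ (by simp)]
    exact ⟨fun h => ⟨0, by rw [h]; rfl⟩, fun ⟨g, hg⟩ => hg.symm⟩
  | succ n =>
    rw [P.extMk_eq_zero_iff _ _ _ _ n rfl]
    change _ ↔ ∃ g, ((P.complex.linearYonedaObj R N).d _ (n + 1)).hom g = _
    rw [CochainComplex.prev_nat_succ]
    rfl

end comparison

/-- The left derived `Ext` modules agree with the `Ext` modules of the derived category. -/
def modExtEquiv {R : Type} [CommRing R] (n : ℕ) (M N : ModuleCat R) :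
    ModExt R n M N ≃ₗ[R] Abelian.Ext M N n :=
  let P := projectiveResolution M
  (P.isoExt n N ≪≫ ((P.complex.linearYonedaObj R N).sc n).moduleCatHomologyIso).toLinearEquiv ≪≫ₗ
    Submodule.quotEquivOfEq _ _ (ker_cocycleToExt P n).symm ≪≫ₗ
    (cocycleToExt P n).quotKerEquivOfSurjective (cocycleToExt_surjective P n)

section depth

open Abelian IsLocalRing Pointwise

section ExtMaps

variable (R : Type) [CommRing R]

/-- `Ext` groups of unbundled modules. -/
abbrev ExtOf (M N : Type) [AddCommGroup M] [Module R M] [AddCommGroup N] [Module R N] (n : ℕ) :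
    Type :=
  Abelian.Ext (ModuleCat.of R M) (ModuleCat.of R N) n

variable {R}
variable {A B C X Y : Type} [AddCommGroup A] [Module R A] [AddCommGroup B] [Module R B]
  [AddCommGroup C] [Module R C] [AddCommGroup X] [Module R X] [AddCommGroup Y] [Module R Y]

/-- Precomposition with a linear map on `Ext`. -/
def extPre (f : A →ₗ[R] B) (Y : Type) [AddCommGroup Y] [Module R Y] (n : ℕ) :
    ExtOf R B Y n →ₗ[R] ExtOf R A Y n where
  toFun e := (Ext.mk₀ (ModuleCat.ofHom f)).comp e (zero_add n)
  map_add' _ _ := Ext.comp_add ..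
  map_smul' _ _ := Ext.comp_smul ..

/-- Postcomposition with a linear map on `Ext`. -/
def extPost (X : Type) [AddCommGroup X] [Module R X] (f : A →ₗ[R] B) (n : ℕ) :
    ExtOf R X A n →ₗ[R] ExtOf R X B n where
  toFun e := e.comp (Ext.mk₀ (ModuleCat.ofHom f)) (add_zero n)
  map_add' _ _ := Ext.add_comp ..
  map_smul' _ _ := Ext.smul_comp ..

lemma extPre_id (n : ℕ) : extPre (LinearMap.id : A →ₗ[R] A) Y n = LinearMap.id :=
  LinearMap.ext fun e => Ext.mk₀_id_comp e

lemma extPost_id (n : ℕ) : extPost X (LinearMap.id : A →ₗ[R] A) n = LinearMap.id :=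
  LinearMap.ext fun e => Ext.comp_mk₀_id e

lemma extPre_comp (f : A →ₗ[R] B) (g : B →ₗ[R] C) (n : ℕ) :
    extPre (g ∘ₗ f) Y n = extPre f Y n ∘ₗ extPre g Y n := by
  ext e
  simp only [extPre, LinearMap.coe_mk, AddHom.coe_mk, LinearMap.comp_apply]
  rw [ModuleCat.ofHom_comp, ← Ext.mk₀_comp_mk₀, Ext.comp_assoc_of_second_deg_zero]

lemma extPost_comp (f : A →ₗ[R] B) (g : B →ₗ[R] C) (n : ℕ) :
    extPost X (g ∘ₗ f) n = extPost X g n ∘ₗ extPost X f n := by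
  ext e
  simp only [extPost, LinearMap.coe_mk, AddHom.coe_mk, LinearMap.comp_apply]
  rw [ModuleCat.ofHom_comp, ← Ext.mk₀_comp_mk₀, Ext.comp_assoc_of_third_deg_zero]

lemma extPost_add (f g : A →ₗ[R] B) (n : ℕ) :
    extPost X (f + g) n = extPost X f n + extPost X g n := by
  ext e
  simp only [extPost, LinearMap.coe_mk, AddHom.coe_mk, LinearMap.add_apply]
  rw [← Ext.comp_add, ← Ext.mk₀_add]
  rfl

lemma extPost_zero (n : ℕ) : extPost X (0 : A →ₗ[R] B) n = 0 := by
  simpa using extPost_add (X := X) (0 : A →ₗ[R] B) 0 n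

lemma extPre_add (f g : A →ₗ[R] B) (n : ℕ) :
    extPre (f + g) Y n = extPre f Y n + extPre g Y n := by
  ext e
  simp only [extPre, LinearMap.coe_mk, AddHom.coe_mk, LinearMap.add_apply]
  rw [← Ext.add_comp, ← Ext.mk₀_add]
  rfl

lemma extPre_zero (n : ℕ) : extPre (0 : A →ₗ[R] B) Y n = 0 := by
  simpa using extPre_add (Y := Y) (0 : A →ₗ[R] B) 0 n

lemma extPost_sum {ι : Type*} (s : Finset ι) (f : ι → A →ₗ[R] B) (n : ℕ) :
    extPost X (∑ i ∈ s, f i) n = ∑ i ∈ s, extPost X (f i) n := by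
  classical
  induction s using Finset.induction_on with
  | empty => simpa using extPost_zero n
  | insert i s hi ih => rw [Finset.sum_insert hi, Finset.sum_insert hi, extPost_add, ih]

lemma extPost_smul_id (x : R) (n : ℕ) :
    extPost X (x • LinearMap.id : A →ₗ[R] A) n = x • LinearMap.id :=
  LinearMap.ext fun e => (Ext.smul_eq_comp_mk₀ e x).symm

lemma extPre_smul_id (x : R) (n : ℕ) :
    extPre (x • LinearMap.id : A →ₗ[R] A) Y n = x • LinearMap.id := by
  ext e
  change (Ext.mk₀ (x • 𝟙 (ModuleCat.of R A))).comp e (zero_add n) = x • e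
  rw [Ext.mk₀_smul, Ext.smul_comp, Ext.mk₀_id_comp]

variable (R A Y) in
/-- `Ext^0` is `Hom`. -/
def extOfZeroEquiv : ExtOf R A Y 0 ≃+ (A →ₗ[R] Y) :=
  Ext.addEquiv₀.trans ModuleCat.homAddEquiv

lemma extOfZeroEquiv_mk₀ (v : ModuleCat.of R A ⟶ ModuleCat.of R Y) :
    extOfZeroEquiv R A Y (Ext.mk₀ v) = v.hom :=
  congrArg ModuleCat.Hom.hom (Ext.addEquiv₀.apply_symm_apply v)

lemma extOfZeroEquiv_extPre (f : A →ₗ[R] B) (e : ExtOf R B Y 0) :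
    extOfZeroEquiv R A Y (extPre f Y 0 e) = extOfZeroEquiv R B Y e ∘ₗ f := by
  obtain ⟨v, rfl⟩ := (Ext.mk₀_bijective _ _).2 e
  rw [extOfZeroEquiv_mk₀]
  exact (congrArg _ (Ext.mk₀_comp_mk₀ _ _)).trans (extOfZeroEquiv_mk₀ _)

lemma extOfZeroEquiv_extPost (f : A →ₗ[R] B) (e : ExtOf R X A 0) :
    extOfZeroEquiv R X B (extPost X f 0 e) = f ∘ₗ extOfZeroEquiv R X A e := by
  obtain ⟨v, rfl⟩ := (Ext.mk₀_bijective _ _).2 e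
  rw [extOfZeroEquiv_mk₀]
  exact (congrArg _ (Ext.mk₀_comp_mk₀ _ _)).trans (extOfZeroEquiv_mk₀ _)

/-- `0 → A → B → C → 0` is a short exact sequence. -/
structure IsSES (f : A →ₗ[R] B) (g : B →ₗ[R] C) : Prop where
  inj : Function.Injective f
  surj : Function.Surjective g
  exact : Function.Exact f g

namespace IsSES

variable {f : A →ₗ[R] B} {g : B →ₗ[R] C} (h : IsSES f g)
include h

lemma shortExact : (ShortComplex.mk (ModuleCat.ofHom f) (ModuleCat.ofHom g)
    (ModuleCat.hom_ext h.exact.linearMap_comp_eq_zero)).ShortExact where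
  exact := ModuleCat.shortComplex_exact _ h.exact
  mono_f := (ModuleCat.mono_iff_injective _).mpr h.inj
  epi_g := (ModuleCat.epi_iff_surjective _).mpr h.surj

/-- The class in `Ext^1(C, A)` of a short exact sequence. -/
def cls : ExtOf R C A 1 := h.shortExact.extClass

/-- The connecting map of the contravariant long exact sequence. -/
def connPre (Y : Type) [AddCommGroup Y] [Module R Y] (n : ℕ) :
    ExtOf R A Y n →ₗ[R] ExtOf R C Y (n + 1) where
  toFun e := h.cls.comp e (add_comm 1 n)
  map_add' _ _ := Ext.comp_add ..
  map_smul' _ _ := Ext.comp_smul ..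

/-- The connecting map of the covariant long exact sequence. -/
def connPost (X : Type) [AddCommGroup X] [Module R X] (n : ℕ) :
    ExtOf R X C n →ₗ[R] ExtOf R X A (n + 1) where
  toFun e := e.comp h.cls rfl
  map_add' _ _ := Ext.add_comp ..
  map_smul' _ _ := Ext.smul_comp ..

lemma exists_extPre_of_connPre {n : ℕ} (e : ExtOf R A Y n) (he : h.connPre Y n e = 0) :
    ∃ e', extPre f Y n e' = e :=
  Ext.contravariant_sequence_exact₁ h.shortExact _ e (add_comm 1 n) he

lemma exists_extPre_of_extPre {n : ℕ} (e : ExtOf R B Y n) (he : extPre f Y n e = 0) :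
    ∃ e', extPre g Y n e' = e :=
  Ext.contravariant_sequence_exact₂ h.shortExact _ e he

lemma exists_connPre {n : ℕ} (e : ExtOf R C Y (n + 1)) (he : extPre g Y (n + 1) e = 0) :
    ∃ e', h.connPre Y n e' = e :=
  Ext.contravariant_sequence_exact₃ h.shortExact _ e he (add_comm 1 n)

lemma exists_extPost_of_connPost {n : ℕ} (e : ExtOf R X C n) (he : h.connPost X n e = 0) :
    ∃ e', extPost X g n e' = e :=
  Ext.covariant_sequence_exact₃ _ h.shortExact e rfl he

lemma exists_connPost {n : ℕ} (e : ExtOf R X A (n + 1)) (he : extPost X f (n + 1) e = 0) :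
    ∃ e', h.connPost X n e' = e :=
  Ext.covariant_sequence_exact₁ _ h.shortExact e he rfl

lemma extPost_injective : Function.Injective (extPost X f 0) := by
  intro a b hab
  apply (extOfZeroEquiv R X A).injective
  have := congrArg (extOfZeroEquiv R X B) hab
  rw [extOfZeroEquiv_extPost, extOfZeroEquiv_extPost] at this
  exact LinearMap.ext fun v => h.inj (LinearMap.congr_fun this v)

lemma subsingleton_ext_mid (Y : Type) [AddCommGroup Y] [Module R Y] (n : ℕ)
    (h₁ : Subsingleton (ExtOf R A Y n)) (h₃ : Subsingleton (ExtOf R C Y n)) :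
    Subsingleton (ExtOf R B Y n) := by
  refine subsingleton_of_forall_eq 0 fun e => ?_
  obtain ⟨e', rfl⟩ := h.exists_extPre_of_extPre e (Subsingleton.elim _ _)
  rw [Subsingleton.elim e' 0, map_zero]

lemma subsingleton_ext_right (Y : Type) [AddCommGroup Y] [Module R Y] (n : ℕ)
    (h₁ : Subsingleton (ExtOf R A Y n)) (h₂ : Subsingleton (ExtOf R B Y (n + 1))) :
    Subsingleton (ExtOf R C Y (n + 1)) := by
  refine subsingleton_of_forall_eq 0 fun e => ?_
  obtain ⟨e', rfl⟩ := h.exists_connPre e (Subsingleton.elim _ _)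
  rw [Subsingleton.elim e' 0, map_zero]

lemma subsingleton_ext_left (Y : Type) [AddCommGroup Y] [Module R Y] (n : ℕ)
    (h₂ : Subsingleton (ExtOf R B Y n)) (h₃ : Subsingleton (ExtOf R C Y (n + 1))) :
    Subsingleton (ExtOf R A Y n) := by
  refine subsingleton_of_forall_eq 0 fun e => ?_
  obtain ⟨e', rfl⟩ := h.exists_extPre_of_connPre e (Subsingleton.elim _ _)
  rw [Subsingleton.elim e' 0, map_zero]

lemma subsingleton_ext_right' (X : Type) [AddCommGroup X] [Module R X] (n : ℕ)
    (h₂ : Subsingleton (ExtOf R X B n)) (h₁ : Subsingleton (ExtOf R X A (n + 1))) :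
    Subsingleton (ExtOf R X C n) := by
  refine subsingleton_of_forall_eq 0 fun e => ?_
  obtain ⟨e', rfl⟩ := h.exists_extPost_of_connPost e (Subsingleton.elim _ _)
  rw [Subsingleton.elim e' 0, map_zero]

lemma exists_extend (hY : Subsingleton (ExtOf R C Y 1)) (u : A →ₗ[R] Y) :
    ∃ v : B →ₗ[R] Y, v ∘ₗ f = u := by
  obtain ⟨e, he⟩ := h.exists_extPre_of_connPre ((extOfZeroEquiv R A Y).symm u)
    (Subsingleton.elim (α := ExtOf R C Y 1) _ _)
  exact ⟨extOfZeroEquiv R B Y e, by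
    rw [← extOfZeroEquiv_extPre, he, AddEquiv.apply_symm_apply]⟩

lemma exists_lift (hX : Subsingleton (ExtOf R X A 1)) (u : X →ₗ[R] C) :
    ∃ v : X →ₗ[R] B, g ∘ₗ v = u := by
  obtain ⟨e, he⟩ := h.exists_extPost_of_connPost ((extOfZeroEquiv R X C).symm u)
    (Subsingleton.elim (α := ExtOf R X A 1) _ _)
  exact ⟨extOfZeroEquiv R X B e, by
    rw [← extOfZeroEquiv_extPost, he, AddEquiv.apply_symm_apply]⟩

variable {A' B' C' : Type} [AddCommGroup A'] [Module R A'] [AddCommGroup B'] [Module R B']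
  [AddCommGroup C'] [Module R C'] {f' : A' →ₗ[R] B'} {g' : B' →ₗ[R] C'} (h' : IsSES f' g')
include h'

lemma connPre_extPre (a : A →ₗ[R] A') (b : B →ₗ[R] B') (c : C →ₗ[R] C')
    (hab : b ∘ₗ f = f' ∘ₗ a) (hbc : c ∘ₗ g = g' ∘ₗ b) (n : ℕ) (e : ExtOf R A' Y n) :
    h.connPre Y n (extPre a Y n e) = extPre c Y (n + 1) (h'.connPre Y n e) := by
  have key := ShortComplex.ShortExact.extClass_naturality h.shortExact h'.shortExact
    { τ₁ := ModuleCat.ofHom a, τ₂ := ModuleCat.ofHom b, τ₃ := ModuleCat.ofHom c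
      comm₁₂ := ModuleCat.hom_ext hab.symm, comm₂₃ := ModuleCat.hom_ext hbc.symm }
  change h.cls.comp ((Ext.mk₀ (ModuleCat.ofHom a)).comp e (zero_add n)) (add_comm 1 n) =
    (Ext.mk₀ (ModuleCat.ofHom c)).comp (h'.cls.comp e (add_comm 1 n)) (zero_add _)
  change h.cls.comp (Ext.mk₀ (ModuleCat.ofHom a)) (add_zero 1) =
    (Ext.mk₀ (ModuleCat.ofHom c)).comp h'.cls (zero_add 1) at key
  rw [← Ext.comp_assoc_of_second_deg_zero, key, Ext.comp_assoc _ _ _ _ _ (by omega)]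

lemma connPost_extPost (a : A →ₗ[R] A') (b : B →ₗ[R] B') (c : C →ₗ[R] C')
    (hab : b ∘ₗ f = f' ∘ₗ a) (hbc : c ∘ₗ g = g' ∘ₗ b) (n : ℕ) (e : ExtOf R X C n) :
    h'.connPost X n (extPost X c n e) = extPost X a (n + 1) (h.connPost X n e) := by
  have key := ShortComplex.ShortExact.extClass_naturality h.shortExact h'.shortExact
    { τ₁ := ModuleCat.ofHom a, τ₂ := ModuleCat.ofHom b, τ₃ := ModuleCat.ofHom c
      comm₁₂ := ModuleCat.hom_ext hab.symm, comm₂₃ := ModuleCat.hom_ext hbc.symm }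
  change (e.comp (Ext.mk₀ (ModuleCat.ofHom c)) (add_zero n)).comp h'.cls rfl =
    (e.comp h.cls rfl).comp (Ext.mk₀ (ModuleCat.ofHom a)) (add_zero _)
  change h.cls.comp (Ext.mk₀ (ModuleCat.ofHom a)) (add_zero 1) =
    (Ext.mk₀ (ModuleCat.ofHom c)).comp h'.cls (zero_add 1) at key
  rw [Ext.comp_assoc_of_second_deg_zero, ← key, Ext.comp_assoc _ _ _ _ _ (by omega)]

end IsSES

lemma isSES_of_injective (f : A →ₗ[R] B) (hf : Function.Injective f) :
    IsSES f f.range.mkQ :=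
  ⟨hf, Submodule.mkQ_surjective _, LinearMap.exact_map_mkQ_range f⟩

lemma isSES_quotSMulTop {x : R} (reg : IsSMulRegular A x) :
    IsSES (x • LinearMap.id : A →ₗ[R] A) (x • (⊤ : Submodule R A)).mkQ where
  inj := reg
  surj := Submodule.mkQ_surjective _
  exact := fun b => by
    rw [Submodule.mkQ_apply, Submodule.Quotient.mk_eq_zero]
    constructor
    · rintro ⟨a, _, rfl⟩
      exact ⟨a, rfl⟩
    · rintro ⟨a, rfl⟩
      exact Submodule.smul_mem_pointwise_smul _ _ ⊤ trivial

lemma extPre_injective_of_leftInverse (i : A →ₗ[R] B) (p : B →ₗ[R] A)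
    (hpi : p ∘ₗ i = LinearMap.id) (n : ℕ) : Function.Injective (extPre p Y n) := by
  refine Function.LeftInverse.injective (g := extPre i Y n) fun e => ?_
  rw [← LinearMap.comp_apply, ← extPre_comp, hpi, extPre_id, LinearMap.id_apply]

lemma subsingleton_extOf_of_equiv (e : A ≃ₗ[R] B) (n : ℕ) (h : Subsingleton (ExtOf R B Y n)) :
    Subsingleton (ExtOf R A Y n) :=
  (extPre_injective_of_leftInverse (Y := Y) e.toLinearMap e.symm.toLinearMap
    (LinearMap.ext fun v => e.symm_apply_apply v) n).subsingleton

lemma extPost_injective_of_leftInverse (i : A →ₗ[R] B) (p : B →ₗ[R] A)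
    (hpi : p ∘ₗ i = LinearMap.id) (n : ℕ) : Function.Injective (extPost X i n) := by
  refine Function.LeftInverse.injective (g := extPost X p n) fun e => ?_
  rw [← LinearMap.comp_apply, ← extPost_comp, hpi, extPost_id, LinearMap.id_apply]

lemma subsingleton_extOf_prod (n : ℕ) (hA : Subsingleton (ExtOf R X A n))
    (hB : Subsingleton (ExtOf R X B n)) : Subsingleton (ExtOf R X (A × B) n) := by
  refine subsingleton_of_forall_eq 0 fun e => ?_
  have key : e = extPost X (LinearMap.inl R A B ∘ₗ LinearMap.fst R A B +
      LinearMap.inr R A B ∘ₗ LinearMap.snd R A B) n e := by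
    rw [show LinearMap.inl R A B ∘ₗ LinearMap.fst R A B +
      LinearMap.inr R A B ∘ₗ LinearMap.snd R A B = LinearMap.id by ext <;> simp, extPost_id]
    rfl
  rw [key, extPost_add, extPost_comp, extPost_comp, LinearMap.add_apply, LinearMap.comp_apply,
    LinearMap.comp_apply, Subsingleton.elim (extPost X (LinearMap.fst R A B) n e) 0,
    Subsingleton.elim (extPost X (LinearMap.snd R A B) n e) 0, map_zero, map_zero, add_zero]

lemma subsingleton_extOf_pi {ι : Type} [Fintype ι] (n : ℕ)
    (hA : Subsingleton (ExtOf R X A n)) : Subsingleton (ExtOf R X (ι → A) n) := by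
  classical
  refine subsingleton_of_forall_eq 0 fun e => ?_
  have key : e = extPost X (∑ i : ι, LinearMap.single R (fun _ => A) i ∘ₗ LinearMap.proj i) n e := by
    rw [show ∑ i : ι, LinearMap.single R (fun _ => A) i ∘ₗ LinearMap.proj i = LinearMap.id from
      LinearMap.ext fun v => by simp [Finset.univ_sum_single], extPost_id]
    rfl
  rw [key, extPost_sum, LinearMap.sum_apply]
  refine Finset.sum_eq_zero fun i _ => ?_
  rw [extPost_comp, LinearMap.comp_apply, Subsingleton.elim (extPost X _ n e) 0, map_zero]

end ExtMaps

section Local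

variable {R : Type} [CommRing R] [IsLocalRing R]
variable {A B M N Y : Type} [AddCommGroup A] [Module R A] [AddCommGroup B] [Module R B]
  [AddCommGroup M] [Module R M] [AddCommGroup N] [Module R N] [AddCommGroup Y] [Module R Y]

lemma subsingleton_of_forall_eq_smul {V : Type*} [AddCommGroup V] [Module R V] [Module.Finite R V]
    {x : R} (hx : x ∈ maximalIdeal R) (h : ∀ v : V, ∃ w : V, v = x • w) : Subsingleton V := by
  by_contra hV
  rw [not_subsingleton_iff_nontrivial] at hV
  refine Submodule.top_ne_pointwise_smul_of_mem_jacobson_annihilator (M := V)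
    (maximalIdeal_le_jacobson (Module.annihilator R V) hx) ?_
  rw [eq_comm, eq_top_iff]
  intro v _
  obtain ⟨w, rfl⟩ := h v
  exact Submodule.smul_mem_pointwise_smul _ _ ⊤ trivial

lemma subsingleton_ext_of_quotSMulTop [IsNoetherianRing R] [Module.Finite R M]
    [Module.Finite R Y] {x : R} (hx : x ∈ maximalIdeal R) (reg : IsSMulRegular M x) (n : ℕ)
    (h : Subsingleton (ExtOf R (QuotSMulTop x M) Y (n + 1))) :
    Subsingleton (ExtOf R M Y n) := by
  refine subsingleton_of_forall_eq_smul hx fun e => ?_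
  obtain ⟨e', rfl⟩ := (isSES_quotSMulTop reg).exists_extPre_of_connPre e (h.elim _ _)
  exact ⟨e', by rw [extPre_smul_id]; rfl⟩

lemma smul_residueField {x : R} (hx : x ∈ maximalIdeal R) (v : ResidueField R) : x • v = 0 := by
  rw [Algebra.smul_def, ResidueField.algebraMap_eq, (residue_eq_zero_iff x).mpr hx, zero_mul]

lemma smul_ext_residueField {x : R} (hx : x ∈ maximalIdeal R) {n : ℕ}
    (e : ExtOf R (ResidueField R) M n) : x • e = 0 := by
  have h : (x • LinearMap.id : ResidueField R →ₗ[R] ResidueField R) = 0 :=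
    LinearMap.ext fun v => smul_residueField hx v
  have key := LinearMap.congr_fun (extPre_smul_id (A := ResidueField R) (Y := M) x n) e
  rw [h, extPre_zero] at key
  exact key.symm

lemma mem_maximalIdeal_of_mem_annihilator {x : R}
    (hx : x ∈ Module.annihilator R (ResidueField R)) : x ∈ maximalIdeal R := by
  rw [Module.mem_annihilator] at hx
  have := hx 1
  rwa [Algebra.smul_def, mul_one, ResidueField.algebraMap_eq, residue_eq_zero_iff] at this

variable (R) in
/-- `Ext^i(k, M)` vanishes for `i < t`. -/
def DepthGE (t : ℕ) (M : Type) [AddCommGroup M] [Module R M] : Prop :=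
  ∀ i < t, Subsingleton (ExtOf R (ResidueField R) M i)

namespace DepthGE

lemma prod {t : ℕ} (hM : DepthGE R t M) (hN : DepthGE R t N) : DepthGE R t (M × N) :=
  fun i hi => subsingleton_extOf_prod i (hM i hi) (hN i hi)

lemma pi {t : ℕ} (hM : DepthGE R t M) (ι : Type) [Fintype ι] : DepthGE R t (ι → M) :=
  fun i hi => subsingleton_extOf_pi i (hM i hi)

lemma of_leftInverse {t : ℕ} (i : M →ₗ[R] N) (p : N →ₗ[R] M) (hpi : p ∘ₗ i = LinearMap.id)
    (hN : DepthGE R t N) : DepthGE R t M := fun j hj =>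
  have := hN j hj
  (extPost_injective_of_leftInverse i p hpi j).subsingleton

lemma exists_regular_prod [IsNoetherianRing R] {t : ℕ}
    [Module.Finite R M] [Module.Finite R N] (hM : DepthGE R (t + 1) M)
    (hN : DepthGE R (t + 1) N) :
    ∃ x ∈ maximalIdeal R, IsSMulRegular M x ∧ IsSMulRegular N x := by
  have := hM.prod hN 0 t.succ_pos
  have : Subsingleton (ResidueField R →ₗ[R] M × N) :=
    (extOfZeroEquiv R (ResidueField R) (M × N)).symm.injective.subsingleton
  obtain ⟨x, hx, reg⟩ := IsSMulRegular.subsingleton_linearMap_iff.mp this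
  refine ⟨x, mem_maximalIdeal_of_mem_annihilator hx, fun a b hab => ?_, fun a b hab => ?_⟩
  · exact (Prod.ext_iff.mp (@reg (a, 0) (b, 0) (Prod.ext hab rfl))).1
  · exact (Prod.ext_iff.mp (@reg (0, a) (0, b) (Prod.ext rfl hab))).2

lemma exists_regular [IsNoetherianRing R] {t : ℕ} [Module.Finite R M]
    (hM : DepthGE R (t + 1) M) : ∃ x ∈ maximalIdeal R, IsSMulRegular M x :=
  let ⟨x, hx, reg, _⟩ := hM.exists_regular_prod hM
  ⟨x, hx, reg⟩

lemma quotSMulTop {t : ℕ} (hM : DepthGE R (t + 1) M) {x : R} (reg : IsSMulRegular M x) :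
    DepthGE R t (QuotSMulTop x M) := fun i hi =>
  (isSES_quotSMulTop reg).subsingleton_ext_right' _ i (hM i (by omega)) (hM (i + 1) (by omega))

lemma of_quotSMulTop {t : ℕ} {x : R} (hx : x ∈ maximalIdeal R)
    (reg : IsSMulRegular M x) (hM : DepthGE R t (QuotSMulTop x M)) :
    DepthGE R (t + 1) M := by
  intro i hi
  refine subsingleton_of_forall_eq 0 fun e => ?_
  have he : extPost _ (x • LinearMap.id : M →ₗ[R] M) i e = 0 := by
    rw [extPost_smul_id]
    exact smul_ext_residueField hx e
  cases i with
  | zero => exact (isSES_quotSMulTop reg).extPost_injective (he.trans (map_zero _).symm)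
  | succ i =>
    obtain ⟨e', rfl⟩ := (isSES_quotSMulTop reg).exists_connPost e he
    have := hM i (by omega)
    rw [Subsingleton.elim e' 0, map_zero]

end DepthGE

lemma nontrivial_ext_quotSMulTop {t : ℕ} {x : R} (hx : x ∈ maximalIdeal R)
    (reg : IsSMulRegular M x) (h : Nontrivial (ExtOf R (ResidueField R) M (t + 1))) :
    Nontrivial (ExtOf R (ResidueField R) (QuotSMulTop x M) t) := by
  by_contra hn
  rw [not_nontrivial_iff_subsingleton] at hn
  obtain ⟨e, he⟩ := exists_ne (0 : ExtOf R (ResidueField R) M (t + 1))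
  obtain ⟨e', rfl⟩ := (isSES_quotSMulTop reg).exists_connPost e (by
    rw [extPost_smul_id]
    exact smul_ext_residueField hx e)
  rw [Subsingleton.elim e' 0, map_zero] at he
  exact he rfl

lemma injective_of_residueField (f : ResidueField R →ₗ[R] M) (hf : f ≠ 0) :
    Function.Injective f := by
  rw [← LinearMap.ker_eq_bot, eq_bot_iff]
  intro v hv
  by_contra hne
  refine hf (LinearMap.ext fun w => ?_)
  obtain ⟨r, hr⟩ := residue_surjective (w * v⁻¹)
  have : w = r • v := by
    rw [Algebra.smul_def, ResidueField.algebraMap_eq, hr, mul_assoc, inv_mul_cancel₀ hne, mul_one]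
  rw [this, map_smul, LinearMap.mem_ker.mp hv, smul_zero, LinearMap.zero_apply]

lemma exists_injective_of_nontrivial_ext_zero
    (h : Nontrivial (ExtOf R (ResidueField R) M 0)) :
    ∃ f : ResidueField R →ₗ[R] M, Function.Injective f := by
  obtain ⟨e, he⟩ := exists_ne (0 : ExtOf R (ResidueField R) M 0)
  exact ⟨extOfZeroEquiv R _ _ e, injective_of_residueField _
    ((AddEquiv.map_ne_zero_iff _).mpr he)⟩

variable [IsNoetherianRing R]

variable (R) in
/-- `Ext^i(N, Y)` vanishes for all finite `N` and `i ≥ r`. -/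
def ExtVanish (r : ℕ) (Y : Type) [AddCommGroup Y] [Module R Y] : Prop :=
  ∀ (N : Type) [AddCommGroup N] [Module R N] [Module.Finite R N], ∀ i ≥ r,
    Subsingleton (ExtOf R N Y i)

lemma subsingleton_ext_residueField {r : ℕ} (hY : ExtVanish R (r + 1) Y) (t : ℕ) :
    ∀ (M : Type) [AddCommGroup M] [Module R M] [Module.Finite R M], t ≤ r → DepthGE R t M →
      Nontrivial (ExtOf R (ResidueField R) M t) →
      (∀ j ≥ r - t, Subsingleton (ExtOf R M Y j)) →
      Subsingleton (ExtOf R (ResidueField R) Y r) := by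
  induction t with
  | zero =>
    intro M _ _ _ _ _ hM hj
    obtain ⟨f, hf⟩ := exists_injective_of_nontrivial_ext_zero hM
    exact (isSES_of_injective f hf).subsingleton_ext_left Y r (hj r (by omega))
      (hY _ _ le_rfl)
  | succ t ih =>
    intro M _ _ _ ht hd hM hj
    obtain ⟨x, hx, reg⟩ := hd.exists_regular
    refine ih (QuotSMulTop x M) (by omega) (hd.quotSMulTop reg)
      (nontrivial_ext_quotSMulTop hx reg hM) fun j hj' => ?_
    obtain ⟨j, rfl⟩ : ∃ i, j = i + 1 := ⟨j - 1, by omega⟩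
    exact (isSES_quotSMulTop reg).subsingleton_ext_right Y j (hj j (by omega))
      (hj (j + 1) (by omega))

lemma ExtVanish.of_residueField [Module.Finite R Y] {r : ℕ} (hY : ExtVanish R (r + 1) Y)
    (h : Subsingleton (ExtOf R (ResidueField R) Y r)) : ExtVanish R r Y := by
  intro N _ _ hN i hi
  rcases hi.lt_or_eq with hi | rfl
  · exact hY N i hi
  induction hN using IsNoetherianRing.induction_on_isQuotientEquivQuotientPrime R with
  | subsingleton N =>
    refine subsingleton_of_forall_eq 0 fun e => ?_
    have := LinearMap.congr_fun (extPre_id (A := N) (Y := Y) r) e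
    rw [Subsingleton.elim (LinearMap.id : N →ₗ[R] N) 0, extPre_zero] at this
    exact this.symm
  | quotient N p e =>
    refine subsingleton_extOf_of_equiv e r ?_
    by_cases hp : p.asIdeal = maximalIdeal R
    · rw [hp]; exact h
    · obtain ⟨x, hx, hxp⟩ := SetLike.exists_of_lt ((le_maximalIdeal p.2.ne_top).lt_of_ne hp)
      refine subsingleton_ext_of_quotSMulTop hx ?_ r (hY _ _ le_rfl)
      intro a b hab
      obtain ⟨a, rfl⟩ := Ideal.Quotient.mk_surjective a
      obtain ⟨b, rfl⟩ := Ideal.Quotient.mk_surjective b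
      rw [Ideal.Quotient.eq]
      refine (p.2.mem_or_mem (x := x) ?_).resolve_left hxp
      rw [mul_sub]
      exact Ideal.Quotient.eq.mp hab
  | exact N₁ N₂ N₃ f g hf hg hfg h₁ h₃ =>
    exact (IsSES.mk hf hg hfg).subsingleton_ext_mid Y r h₁ h₃

lemma ExtVanish.of_le_depth [Module.Finite R Y] {d : ℕ} (hd : DepthGE R d R)
    (hd' : Nontrivial (ExtOf R (ResidueField R) R d)) {r : ℕ} (hY : ExtVanish R r Y) :
    ExtVanish R (d + 1) Y := by
  induction r with
  | zero => exact fun N _ _ _ i _ => hY N i i.zero_le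
  | succ r ih =>
    by_cases hr : r ≤ d
    · exact fun N _ _ _ i hi => hY N i (by omega)
    refine ih (hY.of_residueField (subsingleton_ext_residueField hY d R (by omega) hd hd' ?_))
    intro j hj
    obtain ⟨j, rfl⟩ : ∃ i, j = i + 1 := ⟨j - 1, by omega⟩
    exact subsingleton_of_forall_eq 0 fun e => e.eq_zero_of_projective

lemma ExtVanish.subsingleton_of_depthGE [Module.Finite R Y] {d : ℕ}
    (hY : ExtVanish R (d + 1) Y) (t : ℕ) :
    ∀ (M : Type) [AddCommGroup M] [Module R M] [Module.Finite R M] (j : ℕ), DepthGE R t M →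
      d < j + t → Subsingleton (ExtOf R M Y j) := by
  induction t with
  | zero => exact fun M _ _ _ j _ hj => hY M j hj
  | succ t ih =>
    intro M _ _ _ j hM hj
    obtain ⟨x, hx, reg⟩ := hM.exists_regular
    exact subsingleton_ext_of_quotSMulTop hx reg j
      (ih (QuotSMulTop x M) (j + 1) (hM.quotSMulTop reg) (by omega))

lemma supportDim_quotSMulTop_le [Module.Finite R M] {t : ℕ} {x : R} (hx : x ∈ maximalIdeal R)
    (reg : IsSMulRegular M x) (h : Module.supportDim R M ≤ (t + 1 : ℕ)) :
    Module.supportDim R (QuotSMulTop x M) ≤ t := by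
  rw [← Module.supportDim_quotSMulTop_succ_eq_supportDim reg hx, Nat.cast_succ] at h
  exact ENat.WithBot.add_le_add_one_right_iff.mp h

lemma exists_residueField_injective_of_supportDim_le_zero [Module.Finite R M] [Nontrivial M]
    (h : Module.supportDim R M ≤ 0) : ∃ f : ResidueField R →ₗ[R] M, Function.Injective f := by
  have h0 : Module.supportDim R M = 0 :=
    h.antisymm (Order.krullDim_nonneg_iff.mpr
      Module.nonempty_support_of_nontrivial.to_subtype)
  obtain ⟨p, hp⟩ := associatedPrimes.nonempty R M
  obtain ⟨hpp, f, hf⟩ := (isAssociatedPrime_iff_exists_injective_linearMap p M).mp hp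
  have hmem : (⟨p, hpp⟩ : PrimeSpectrum R) ∈ Module.support R M := by
    rw [Module.support_eq_zeroLocus]
    have := hp.annihilator_le
    rwa [Submodule.annihilator_top] at this
  rw [support_of_supportDim_eq_zero R M h0] at hmem
  obtain rfl : p = maximalIdeal R := (le_maximalIdeal hpp.ne_top).antisymm hmem
  exact ⟨f, hf⟩

omit [IsLocalRing R] in
lemma isArtinian_of_supportDim_le_zero [Module.Finite R M]
    (h : Module.supportDim R M ≤ 0) : IsArtinian R M := by
  rw [Module.supportDim_eq_ringKrullDim_quotient_annihilator] at h
  have : IsArtinianRing (R ⧸ Module.annihilator R M) :=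
    isArtinianRing_iff_krullDimLE_zero.mpr (Ring.krullDimLE_iff.mpr h)
  let _ := Module.quotientAnnihilator (R := R) (M := M)
  have : Module.Finite (R ⧸ Module.annihilator R M) M :=
    Module.Finite.of_restrictScalars_finite R _ M
  exact isArtinian_of_surjective_algebraMap (R := R ⧸ Module.annihilator R M)
    Ideal.Quotient.mk_surjective

lemma injective_and_depthGE_of_surjective_extPre {W : Type} [AddCommGroup W] [Module R W]
    [Module.Finite R W] {d : ℕ} (hW : ExtVanish R (d + 1) W)
    (hk : Nontrivial (ExtOf R (ResidueField R) W d)) (t : ℕ) :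
    ∀ (A B C : Type) [AddCommGroup A] [Module R A] [AddCommGroup B] [Module R B]
      [AddCommGroup C] [Module R C] [Module.Finite R A] [Module.Finite R B] (r : ℕ)
      (f : A →ₗ[R] B) (g : B →ₗ[R] C), t + r = d → DepthGE R t A → DepthGE R t B →
      Module.supportDim R A ≤ t → Function.Surjective g → Function.Exact f g →
      Function.Surjective (extPre f W r) → Function.Injective f ∧ DepthGE R t C := by
  induction t with
  | zero =>
    intro A B C _ _ _ _ _ _ _ _ r f g hr _ _ hdim _ _ hsurj
    obtain rfl : r = d := by omega
    refine ⟨?_, fun i hi => by omega⟩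
    rw [← LinearMap.ker_eq_bot, ← Submodule.subsingleton_iff_eq_bot]
    by_contra hne
    rw [not_subsingleton_iff_nontrivial] at hne
    obtain ⟨u, hu⟩ := exists_residueField_injective_of_supportDim_le_zero (R := R) (M := f.ker)
      ((Module.supportDim_le_of_injective _ f.ker.subtype_injective).trans hdim)
    have hu' : Function.Injective (f.ker.subtype ∘ₗ u) := f.ker.subtype_injective.comp hu
    refine not_subsingleton (ExtOf R (ResidueField R) W r) (subsingleton_of_forall_eq 0 fun e => ?_)
    obtain ⟨e, rfl⟩ := (isSES_of_injective _ hu').exists_extPre_of_connPre e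
      ((hW _ (r + 1) le_rfl).elim _ _)
    obtain ⟨e, rfl⟩ := hsurj e
    rw [← LinearMap.comp_apply, ← extPre_comp, ← LinearMap.comp_assoc, f.comp_ker_subtype,
      LinearMap.zero_comp, extPre_zero, LinearMap.zero_apply]
  | succ t ih =>
    intro A B C _ _ _ _ _ _ _ _ r f g hr hA hB hdim hg hfg hsurj
    obtain ⟨x, hx, regA, regB⟩ := hA.exists_regular_prod hB
    have : Module.Finite R C := Module.Finite.of_surjective g hg
    obtain ⟨hinj, hC⟩ := ih (QuotSMulTop x A) (QuotSMulTop x B) (QuotSMulTop x C) (r + 1)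
      (QuotSMulTop.map x f) (QuotSMulTop.map x g) (by omega) (hA.quotSMulTop regA)
      (hB.quotSMulTop regB) (supportDim_quotSMulTop_le hx regA hdim)
      (QuotSMulTop.map_surjective x hg) (QuotSMulTop.map_exact x hfg hg) fun e => by
        have := hW.subsingleton_of_depthGE (t + 1) A (r + 1) hA (by omega)
        obtain ⟨e, rfl⟩ := (isSES_quotSMulTop regA).exists_connPre e (Subsingleton.elim _ _)
        obtain ⟨e, rfl⟩ := hsurj e
        exact ⟨_, ((isSES_quotSMulTop regA).connPre_extPre (isSES_quotSMulTop regB) f f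
          (QuotSMulTop.map x f) (by ext; simp) (by ext; simp) r e).symm⟩
    have key : ∀ a : A, QuotSMulTop.map x f (Submodule.Quotient.mk a) = 0 → ∃ a', a = x • a' := by
      intro a ha
      have := hinj (ha.trans (map_zero _).symm)
      rw [Submodule.Quotient.mk_eq_zero] at this
      obtain ⟨a', -, rfl⟩ := this
      exact ⟨a', rfl⟩
    refine ⟨?_, DepthGE.of_quotSMulTop hx ?_ hC⟩
    · rw [← LinearMap.ker_eq_bot, ← Submodule.subsingleton_iff_eq_bot]
      refine subsingleton_of_forall_eq_smul hx fun ⟨v, hv⟩ => ?_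
      obtain ⟨w, rfl⟩ := key v (by rw [QuotSMulTop.map_apply_mk, hv, Submodule.Quotient.mk_zero])
      refine ⟨⟨w, regB ?_⟩, rfl⟩
      simpa using hv
    · refine IsSMulRegular.of_right_eq_zero_of_smul fun c hc => ?_
      obtain ⟨b, rfl⟩ := hg c
      rw [← map_smul] at hc
      obtain ⟨a, ha⟩ := (hfg _).mp hc
      obtain ⟨a, rfl⟩ := key a (by
        rw [QuotSMulTop.map_apply_mk, ha, Submodule.Quotient.mk_eq_zero]
        exact Submodule.smul_mem_pointwise_smul _ _ ⊤ trivial)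
      rw [map_smul] at ha
      rw [← regB ha, hfg.apply_apply_eq_zero]

lemma surjective_of_extPost_injective (t : ℕ) :
    ∀ (A : Type) [AddCommGroup A] [Module R A] [Module.Finite R A] (g : A →ₗ[R] A),
      DepthGE R t A → Module.supportDim R A ≤ t →
      Function.Injective (extPost (ResidueField R) g t) → Function.Surjective g := by
  induction t with
  | zero =>
    intro A _ _ _ g _ hdim hg
    have := isArtinian_of_supportDim_le_zero hdim
    refine IsArtinian.surjective_of_injective_endomorphism g ?_
    rw [← LinearMap.ker_eq_bot, ← Submodule.subsingleton_iff_eq_bot]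
    by_contra hne
    rw [not_subsingleton_iff_nontrivial] at hne
    obtain ⟨u, hu⟩ := exists_residueField_injective_of_supportDim_le_zero (R := R) (M := g.ker)
      ((Module.supportDim_le_of_injective _ g.ker.subtype_injective).trans hdim)
    have h0 : (extOfZeroEquiv R _ A).symm (g.ker.subtype ∘ₗ u) = 0 := by
      refine hg ((extOfZeroEquiv R _ A).injective ?_)
      rw [extOfZeroEquiv_extPost, AddEquiv.apply_symm_apply, ← LinearMap.comp_assoc,
        g.comp_ker_subtype, LinearMap.zero_comp, map_zero, map_zero]
    rw [EmbeddingLike.map_eq_zero_iff] at h0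
    have h1 := LinearMap.congr_fun h0 1
    exact one_ne_zero (hu (Subtype.ext (h1.trans (by simp))))
  | succ t ih =>
    intro A _ _ _ g hA hdim hg
    obtain ⟨x, hx, reg⟩ := hA.exists_regular
    have hs := ih (QuotSMulTop x A) (QuotSMulTop.map x g) (hA.quotSMulTop reg)
      (supportDim_quotSMulTop_le hx reg hdim) (by
        rw [injective_iff_map_eq_zero]
        intro e he
        have h0 := (isSES_quotSMulTop reg).connPost_extPost (isSES_quotSMulTop reg) g g
          (QuotSMulTop.map x g) (by ext; simp) (by ext; simp) t e
        rw [he, map_zero] at h0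
        obtain ⟨e, rfl⟩ := (isSES_quotSMulTop reg).exists_extPost_of_connPost e
          (hg (h0.symm.trans (map_zero _).symm))
        have := hA t (by omega)
        rw [Subsingleton.elim e 0, map_zero])
    rw [← LinearMap.range_eq_top, ← Submodule.Quotient.subsingleton_iff]
    refine subsingleton_of_forall_eq_smul hx fun v => ?_
    obtain ⟨a, rfl⟩ := Submodule.Quotient.mk_surjective _ v
    obtain ⟨b, hb⟩ := hs (Submodule.Quotient.mk a)
    obtain ⟨b, rfl⟩ := Submodule.Quotient.mk_surjective _ b
    rw [QuotSMulTop.map_apply_mk, eq_comm, Submodule.Quotient.eq] at hb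
    obtain ⟨c, -, hc⟩ := hb
    refine ⟨Submodule.Quotient.mk c, ?_⟩
    rw [← Submodule.Quotient.mk_smul, Submodule.Quotient.eq]
    exact ⟨b, by rw [← sub_eq_iff_eq_add'.mpr (sub_eq_iff_eq_add.mp hc.symm)]; simp⟩

variable (R) in
/-- `Y` satisfies `Ext^1(X, Y) = 0` for all finite `X` of depth at least `d`. -/
def IsExtOrthogonal (d : ℕ) (Y : Type) [AddCommGroup Y] [Module R Y] : Prop :=
  ∀ (X : Type) [AddCommGroup X] [Module R X] [Module.Finite R X], DepthGE R d X →
    Subsingleton (ExtOf R X Y 1)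

omit [IsNoetherianRing R] in
lemma IsExtOrthogonal.prod {d : ℕ} (hA : IsExtOrthogonal R d A) (hB : IsExtOrthogonal R d B) :
    IsExtOrthogonal R d (A × B) :=
  fun X _ _ _ hX => subsingleton_extOf_prod 1 (hA X hX) (hB X hX)

omit [IsNoetherianRing R] in
lemma IsExtOrthogonal.of_equiv {d : ℕ} (e : A ≃ₗ[R] B) (hB : IsExtOrthogonal R d B) :
    IsExtOrthogonal R d A := fun X _ _ _ hX =>
  have := hB X hX
  (extPost_injective_of_leftInverse e.toLinearMap e.symm.toLinearMap
    (LinearMap.ext e.symm_apply_apply) 1).subsingleton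

lemma ExtVanish.isExtOrthogonal [Module.Finite R Y] {d : ℕ} (hY : ExtVanish R (d + 1) Y) :
    IsExtOrthogonal R d Y :=
  fun X _ _ _ hX => hY.subsingleton_of_depthGE d X 1 hX (by omega)

variable (R) in
/-- The homological properties of a canonical module of a `d`-dimensional local ring. -/
structure IsDualizing (d : ℕ) (W : Type) [AddCommGroup W] [Module R W] : Prop where
  dim : ringKrullDim R = d
  vanish : ExtVanish R (d + 1) W
  depth : DepthGE R d W
  simple : IsSimpleModule R (ExtOf R (ResidueField R) W d)

section Splitting

variable {S : Type} [CommRing S] {V L : Type} [AddCommGroup V] [Module S V] [AddCommGroup L]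
  [Module S L]

/-- The projection onto the kernel of a split surjection. -/
def kerProj (i : V →ₗ[S] L) (p : L →ₗ[S] V) (h : p ∘ₗ i = LinearMap.id) : L →ₗ[S] p.ker :=
  (LinearMap.id - i ∘ₗ p).codRestrict p.ker fun x => by
    simpa [sub_eq_zero] using (LinearMap.congr_fun h (p x)).symm

lemma coe_kerProj (i : V →ₗ[S] L) (p : L →ₗ[S] V) (h : p ∘ₗ i = LinearMap.id) (x : L) :
    (kerProj i p h x : L) = x - i (p x) := rfl

lemma kerProj_subtype (i : V →ₗ[S] L) (p : L →ₗ[S] V) (h : p ∘ₗ i = LinearMap.id) :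
    kerProj i p h ∘ₗ p.ker.subtype = LinearMap.id := by
  ext ⟨x, hx⟩
  have hx : p x = 0 := hx
  simp [coe_kerProj, hx]

/-- A split surjection identifies its source with the product of target and kernel. -/
def splitEquiv (i : V →ₗ[S] L) (p : L →ₗ[S] V) (h : p ∘ₗ i = LinearMap.id) :
    L ≃ₗ[S] V × p.ker :=
  LinearEquiv.ofLinearMap (p.prod (kerProj i p h)) (i.coprod p.ker.subtype)
    (by
      have hi : ∀ v, p (i v) = v := LinearMap.congr_fun h
      refine LinearMap.ext fun ⟨v, x, hx⟩ => ?_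
      have hx : p x = 0 := hx
      ext <;> simp [coe_kerProj, hi, hx])
    (by ext; simp [coe_kerProj])

lemma exists_comp_eq_id_of_bijective (g : V →ₗ[S] V) (hg : Function.Bijective g) :
    ∃ θ : V →ₗ[S] V, g ∘ₗ θ = LinearMap.id :=
  ⟨(LinearEquiv.ofBijective g hg).symm,
    LinearMap.ext fun v => (LinearEquiv.ofBijective g hg).apply_symm_apply v⟩

lemma IsSES.exists_factor {V' P : Type} [AddCommGroup V'] [Module S V']
    [AddCommGroup P] [Module S P] {f : V →ₗ[S] L} {g : L →ₗ[S] V'}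
    (h : IsSES f g) (u : P →ₗ[S] L) (hu : g ∘ₗ u = 0) : ∃ v : P →ₗ[S] V, f ∘ₗ v = u := by
  refine ⟨(LinearEquiv.ofInjective f h.inj).symm ∘ₗ u.codRestrict f.range fun x =>
    (h.exact _).mp (LinearMap.congr_fun hu x), LinearMap.ext fun x => ?_⟩
  exact congrArg Subtype.val ((LinearEquiv.ofInjective f h.inj).apply_symm_apply _)

end Splitting

namespace IsDualizing

variable {d : ℕ} {W X : Type} [AddCommGroup W] [Module R W] [Module.Finite R W]
  [AddCommGroup X] [Module R X] (hW : IsDualizing R d W)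
include hW

omit [Module.Finite R W] [IsNoetherianRing R] in
lemma supportDim_le (X : Type) [AddCommGroup X] [Module R X] : Module.supportDim R X ≤ d :=
  hW.dim ▸ Module.supportDim_le_ringKrullDim R X

lemma bijective_of_ne_zero (g : W →ₗ[R] W) (hg : extPost (ResidueField R) g d ≠ 0) :
    Function.Bijective g :=
  have := hW.simple
  OrzechProperty.bijective_of_surjective_endomorphism g
    (surjective_of_extPost_injective d W g hW.depth (hW.supportDim_le W)
      ((LinearMap.injective_or_eq_zero _).resolve_right hg))

omit [Module.Finite R W] [IsNoetherianRing R] in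
lemma extPost_id_ne_zero : extPost (ResidueField R) (LinearMap.id : W →ₗ[R] W) d ≠ 0 := by
  rw [extPost_id]
  have := hW.simple
  have := IsSimpleModule.nontrivial R (ExtOf R (ResidueField R) W d)
  obtain ⟨e, he⟩ := exists_ne (0 : ExtOf R (ResidueField R) W d)
  exact fun h => he (LinearMap.congr_fun h e)

omit [Module.Finite R W] [IsNoetherianRing R] in
lemma nontrivial : Nontrivial W := by
  by_contra hn
  rw [not_nontrivial_iff_subsingleton] at hn
  refine hW.extPost_id_ne_zero ?_
  rw [Subsingleton.elim (LinearMap.id : W →ₗ[R] W) 0, extPost_zero]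

/-- Maps from modules of maximal depth to `Ext`-orthogonal modules factor through powers of a
dualizing module. -/
lemma exists_factor [Module.Finite R X] (hX : DepthGE R d X) (hY : IsExtOrthogonal R d Y)
    (h : X →ₗ[R] Y) :
    ∃ (n : ℕ) (α : X →ₗ[R] (Fin n → W)) (β : (Fin n → W) →ₗ[R] Y), β ∘ₗ α = h := by
  obtain ⟨n, s, hs⟩ := Module.Finite.exists_fin (R := R) (M := X →ₗ[R] W)
  let α : X →ₗ[R] (Fin n → W) := LinearMap.pi s
  have := hW.simple
  obtain ⟨hinj, hC⟩ := injective_and_depthGE_of_surjective_extPre hW.vanish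
    (IsSimpleModule.nontrivial R _) d X (Fin n → W) _ 0 α α.range.mkQ (add_zero d) hX
    (hW.depth.pi (Fin n)) (hW.supportDim_le X) (Submodule.mkQ_surjective _)
    (LinearMap.exact_map_mkQ_range α) fun e => by
      obtain ⟨c, hc⟩ := (Submodule.mem_span_range_iff_exists_fun R).mp
        (hs ▸ Submodule.mem_top : extOfZeroEquiv R X W e ∈ Submodule.span R (Set.range s))
      refine ⟨(extOfZeroEquiv R _ W).symm (∑ i, c i • LinearMap.proj i),
        (extOfZeroEquiv R X W).injective ?_⟩
      rw [extOfZeroEquiv_extPre, AddEquiv.apply_symm_apply, ← hc]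
      ext x
      simp [α]
  obtain ⟨β, hβ⟩ := (isSES_of_injective α hinj).exists_extend (hY _ hC) h
  exact ⟨n, α, β, hβ⟩

end IsDualizing

variable (R) in
/-- Every composite `W → Y → X → W` through `ι` is zero on `Ext^d(k, -)`. -/
def IsTopRadical (d : ℕ) (W : Type) [AddCommGroup W] [Module R W] {X Y : Type} [AddCommGroup X]
    [Module R X] [AddCommGroup Y] [Module R Y] (ι : Y →ₗ[R] X) : Prop :=
  ∀ (a : W →ₗ[R] Y) (b : X →ₗ[R] W), extPost (ResidueField R) (b ∘ₗ ι ∘ₗ a) d = 0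

omit [IsLocalRing R] [IsNoetherianRing R] in
lemma extPost_pi_eq_zero {n : ℕ} {X : Type} [AddCommGroup X] [Module R X] {m : ℕ}
    (g : (Fin n → A) →ₗ[R] (Fin n → A))
    (h : ∀ i j, extPost X (LinearMap.proj i ∘ₗ g ∘ₗ LinearMap.single R (fun _ => A) j) m = 0) :
    extPost X g m = 0 := by
  have hid : ∑ i, LinearMap.single R (fun _ : Fin n => A) i ∘ₗ LinearMap.proj i =
      LinearMap.id :=
    LinearMap.ext fun v => by simp [Finset.univ_sum_single]
  have hg : g = ∑ i, ∑ j, LinearMap.single R (fun _ => A) i ∘ₗ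
      (LinearMap.proj i ∘ₗ g ∘ₗ LinearMap.single R (fun _ => A) j) ∘ₗ LinearMap.proj j := by
    conv_lhs => rw [← LinearMap.id_comp g, ← LinearMap.comp_id g, ← hid]
    refine LinearMap.ext fun v => funext fun k => ?_
    simp only [LinearMap.comp_apply, LinearMap.sum_apply, map_sum, Finset.sum_apply,
      LinearMap.coe_proj, Function.eval, LinearMap.coe_single]
    rw [Finset.sum_comm]
  rw [hg, extPost_sum]
  refine Finset.sum_eq_zero fun i _ => ?_
  rw [extPost_sum]
  refine Finset.sum_eq_zero fun j _ => ?_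
  rw [extPost_comp, extPost_comp, h, LinearMap.zero_comp, LinearMap.comp_zero]

namespace IsDualizing

variable {d : ℕ} {W X : Type} [AddCommGroup W] [Module R W] [Module.Finite R W]
  [AddCommGroup X] [Module R X] (hW : IsDualizing R d W)
include hW

lemma isTopRadical {Y X : ModuleCat R} {ι : Y →ₗ[R] X} (h : ¬ HasCommonSummandVia R ι) :
    IsTopRadical R d W ι := by
  intro a b
  by_contra hne
  obtain ⟨θ, hθ⟩ := exists_comp_eq_id_of_bijective _ (hW.bijective_of_ne_zero _ hne)
  refine h ⟨ModuleCat.of R W, ModuleCat.of R (b ∘ₗ ι).ker, ModuleCat.of R b.ker, hW.nontrivial,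
    splitEquiv (a ∘ₗ θ) (b ∘ₗ ι) hθ, splitEquiv (ι ∘ₗ a ∘ₗ θ) b hθ,
    (ι ∘ₗ (b ∘ₗ ι).ker.subtype).codRestrict b.ker fun y => y.2, fun y => ?_⟩
  refine Prod.ext rfl (Subtype.ext ?_)
  exact (map_sub ι _ _).symm

variable {ι : Y →ₗ[R] X} {π : X →ₗ[R] M} [Module.Finite R X]

lemma bijective_of_comp_eq (hs : IsSES ι π) (hX : DepthGE R d X) (hY : IsExtOrthogonal R d Y)
    (hι : IsTopRadical R d W ι) (w : X →ₗ[R] X) (hw : π ∘ₗ w = π) : Function.Bijective w := by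
  refine OrzechProperty.bijective_of_surjective_endomorphism w
    (surjective_of_extPost_injective d X w hX (hW.supportDim_le X) ?_)
  obtain ⟨h, hh⟩ := hs.exists_factor (LinearMap.id - w) (by
    rw [LinearMap.comp_sub, hw, LinearMap.comp_id, sub_self])
  obtain ⟨n, α, β, rfl⟩ := hW.exists_factor hX hY h
  have h0 : extPost (ResidueField R) (α ∘ₗ ι ∘ₗ β) d = 0 :=
    extPost_pi_eq_zero _ fun i j =>
    hι (β ∘ₗ LinearMap.single R (fun _ => W) j) ((LinearMap.proj i : (Fin n → W) →ₗ[R] W) ∘ₗ α)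
  rw [injective_iff_map_eq_zero]
  intro e he
  have h1 : extPost (ResidueField R) (ι ∘ₗ β ∘ₗ α) d e = e := by
    have := LinearMap.congr_fun (extPost_add (X := ResidueField R) w (LinearMap.id - w) d) e
    rw [add_sub_cancel, extPost_id, LinearMap.add_apply, he, zero_add, ← hh] at this
    exact this.symm
  have h2 : extPost (ResidueField R) ((ι ∘ₗ β) ∘ₗ (α ∘ₗ ι ∘ₗ β) ∘ₗ α) d e = 0 := by
    rw [extPost_comp, extPost_comp α (α ∘ₗ ι ∘ₗ β), h0, LinearMap.zero_comp,
      LinearMap.comp_zero, LinearMap.zero_apply]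
  rw [← h1, ← h1, ← LinearMap.comp_apply, ← extPost_comp]
  exact h2

/-- Uniqueness of minimal approximations. -/
lemma nonempty_equiv {X' Y' : Type} [AddCommGroup X'] [Module R X'] [AddCommGroup Y'] [Module R Y']
    [Module.Finite R X'] {ι' : Y' →ₗ[R] X'} {π' : X' →ₗ[R] M}
    (hs : IsSES ι π) (hX : DepthGE R d X) (hY : IsExtOrthogonal R d Y)
    (hι : IsTopRadical R d W ι) (hs' : IsSES ι' π') (hX' : DepthGE R d X')
    (hY' : IsExtOrthogonal R d Y') (hι' : IsTopRadical R d W ι') :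
    Nonempty (X ≃ₗ[R] X') ∧ Nonempty (Y ≃ₗ[R] Y') := by
  obtain ⟨u, hu⟩ := hs'.exists_lift (hY' X hX) π
  obtain ⟨v, hv⟩ := hs.exists_lift (hY X' hX') π'
  have hvu := hW.bijective_of_comp_eq hs hX hY hι (v ∘ₗ u) (by
    rw [← LinearMap.comp_assoc, hv, hu])
  have huv := hW.bijective_of_comp_eq hs' hX' hY' hι' (u ∘ₗ v) (by
    rw [← LinearMap.comp_assoc, hu, hv])
  rw [LinearMap.coe_comp] at hvu huv
  have hub : Function.Bijective u := ⟨hvu.1.of_comp, huv.2.of_comp⟩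
  obtain ⟨y, hy⟩ := hs'.exists_factor (u ∘ₗ ι) (by
    rw [← LinearMap.comp_assoc, hu, hs.exact.linearMap_comp_eq_zero])
  refine ⟨⟨LinearEquiv.ofBijective u hub⟩, ⟨LinearEquiv.ofBijective y ⟨?_, fun y' => ?_⟩⟩⟩
  · have : Function.Injective (ι' ∘ₗ y) := hy ▸ hub.1.comp hs.inj
    exact Function.Injective.of_comp this
  · obtain ⟨x, hx⟩ := hub.2 (ι' y')
    obtain ⟨z, rfl⟩ := (hs.exact x).mp (by
      rw [← hu, LinearMap.comp_apply, hx, hs'.exact.apply_apply_eq_zero])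
    exact ⟨z, hs'.inj ((LinearMap.congr_fun hy z).trans hx)⟩

end IsDualizing

namespace IsDualizing

variable {d : ℕ} {W : Type} [AddCommGroup W] [Module R W] [Module.Finite R W]
  (hW : IsDualizing R d W)
include hW

variable {L Y' X' : Type} [AddCommGroup L] [Module R L] [AddCommGroup Y'] [Module R Y']
  [AddCommGroup X'] [Module R X'] [Module.Finite R X'] {φ : W × Y →ₗ[R] X'} {π : X' →ₗ[R] L}

omit [Module.Finite R X'] in
/-- A copy of `W` that splits off from `φ : W × Y → X'` leaves an approximation with kernel
isomorphic to `Y`, provided the maps through `Y` are radical. -/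
lemma exists_cancel (hs : IsSES φ π)
    (hι : IsTopRadical R d W (φ ∘ₗ LinearMap.inr R W Y)) (a : W →ₗ[R] W × Y) (b : X' →ₗ[R] W)
    (hab : (b ∘ₗ φ) ∘ₗ a = LinearMap.id) :
    ∃ (ι' : (b ∘ₗ φ).ker →ₗ[R] b.ker) (π' : b.ker →ₗ[R] L), IsSES ι' π' ∧
      IsTopRadical R d W ι' ∧ Nonempty ((b ∘ₗ φ).ker ≃ₗ[R] Y) := by
  let c : W →ₗ[R] W := b ∘ₗ φ ∘ₗ LinearMap.inl R W Y
  have hdecomp : ∀ {P Q : Type} [AddCommGroup P] [Module R P] [AddCommGroup Q] [Module R Q]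
      (u : P →ₗ[R] W × Y) (v : X' →ₗ[R] Q), v ∘ₗ φ ∘ₗ u =
        (v ∘ₗ φ ∘ₗ LinearMap.inl R W Y) ∘ₗ (LinearMap.fst R W Y ∘ₗ u) +
        v ∘ₗ (φ ∘ₗ LinearMap.inr R W Y) ∘ₗ (LinearMap.snd R W Y ∘ₗ u) := by
    intro P Q _ _ _ _ u v
    ext x
    simp [← map_add]
  have hdec : ∀ (u : W →ₗ[R] W × Y) (v : X' →ₗ[R] W), extPost (ResidueField R) (v ∘ₗ φ ∘ₗ u) d =
      extPost (ResidueField R) (v ∘ₗ φ ∘ₗ LinearMap.inl R W Y) d ∘ₗ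
        extPost (ResidueField R) (LinearMap.fst R W Y ∘ₗ u) d := by
    intro u v
    rw [hdecomp, extPost_add, hι, add_zero, extPost_comp]
  have hc : extPost (ResidueField R) c d ≠ 0 := by
    intro h0
    refine hW.extPost_id_ne_zero ?_
    have := hdec a b
    rw [← LinearMap.comp_assoc, hab] at this
    rw [this]
    change extPost (ResidueField R) c d ∘ₗ _ = 0
    rw [h0, LinearMap.zero_comp]
  have hcb : Function.Bijective c := hW.bijective_of_ne_zero c hc
  have := hW.simple
  have hci : Function.Injective (extPost (ResidueField R) c d) :=
    (LinearMap.injective_or_eq_zero _).resolve_right hc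
  have hφπ : ∀ z, π (φ z) = 0 := hs.exact.apply_apply_eq_zero
  have hab' : b ∘ₗ (φ ∘ₗ a) = LinearMap.id := hab
  have hb : ∀ w y, b (φ (w, y)) = c w + b (φ (0, y)) := by
    intro w y
    simp [c, ← map_add]
  refine ⟨(φ ∘ₗ (b ∘ₗ φ).ker.subtype).codRestrict b.ker fun y => y.2, π ∘ₗ b.ker.subtype,
    ⟨fun z z' h => Subtype.ext (hs.inj (congrArg Subtype.val h)), fun m => ?_, fun x => ?_⟩,
    fun a' b' => ?_, ⟨LinearEquiv.ofBijective
      (LinearMap.snd R W Y ∘ₗ (b ∘ₗ φ).ker.subtype) ⟨?_, fun y => ?_⟩⟩⟩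
  · obtain ⟨x, rfl⟩ := hs.surj m
    refine ⟨kerProj (φ ∘ₗ a) b hab' x, ?_⟩
    change π (x - φ (a (b x))) = π x
    rw [map_sub, hφπ, sub_zero]
  · constructor
    · intro hx
      obtain ⟨z, hz⟩ := (hs.exact x.1).mp hx
      exact ⟨⟨z, show b (φ z) = 0 from hz ▸ x.2⟩, Subtype.ext hz⟩
    · rintro ⟨z, rfl⟩
      exact hφπ z
  · let s := (b ∘ₗ φ).ker.subtype
    have h0 : b ∘ₗ φ ∘ₗ s ∘ₗ a' = 0 := LinearMap.ext fun w => (a' w).2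
    have h1 : extPost (ResidueField R) (LinearMap.fst R W Y ∘ₗ s ∘ₗ a') d = 0 := by
      have h2 := hdec (s ∘ₗ a') b
      rw [h0, extPost_zero] at h2
      exact LinearMap.ext fun e => hci ((LinearMap.congr_fun h2 e).symm.trans (map_zero _).symm)
    have h2 := hdec (s ∘ₗ a') (b' ∘ₗ kerProj (φ ∘ₗ a) b hab')
    rw [h1, LinearMap.comp_zero] at h2
    rw [← h2]
    congr 1
    refine LinearMap.ext fun w => congrArg b' ?_
    exact (LinearMap.congr_fun (kerProj_subtype (φ ∘ₗ a) b hab') _).symm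
  · rw [injective_iff_map_eq_zero]
    rintro ⟨⟨w, y⟩, hz⟩ (rfl : y = 0)
    have hz : b (φ (w, 0)) = 0 := hz
    rw [hb, Prod.mk_zero_zero, map_zero, map_zero, add_zero] at hz
    obtain rfl : w = 0 := hcb.1 (hz.trans (map_zero c).symm)
    rfl
  · obtain ⟨w, hw⟩ := hcb.2 (-b (φ (0, y)))
    exact ⟨⟨(w, y), show b (φ (w, y)) = 0 by rw [hb, hw, neg_add_cancel]⟩, rfl⟩

/-- If `φ : W × Y → X'` is an approximation of `L` whose part through `Y` is radical, and
`ι : Y' → X` is a minimal one, then either they agree or `φ` has exactly one superfluous copy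
of `W`. -/
lemma dichotomy {X : Type} [AddCommGroup X] [Module R X] [Module.Finite R X]
    {ι : Y' →ₗ[R] X} {ρ : X →ₗ[R] L}
    (hs : IsSES φ π) (hX' : DepthGE R d X') (hY : IsExtOrthogonal R d Y)
    (hφ : IsTopRadical R d W (φ ∘ₗ LinearMap.inr R W Y))
    (hs' : IsSES ι ρ) (hX : DepthGE R d X) (hY' : IsExtOrthogonal R d Y')
    (hι : IsTopRadical R d W ι) :
    (Nonempty (X' ≃ₗ[R] X) ∧ Nonempty ((W × Y) ≃ₗ[R] Y')) ∨
      (Nonempty (X' ≃ₗ[R] W × X) ∧ Nonempty (Y ≃ₗ[R] Y')) := by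
  by_cases h : IsTopRadical R d W φ
  · exact .inl (hW.nonempty_equiv hs hX' (hW.vanish.isExtOrthogonal.prod hY) h hs' hX hY' hι)
  · unfold IsTopRadical at h
    push Not at h
    obtain ⟨a, b, hab⟩ := h
    obtain ⟨θ, hθ⟩ := exists_comp_eq_id_of_bijective _ (hW.bijective_of_ne_zero _ hab)
    obtain ⟨ι', π', hs'', hι', ⟨e⟩⟩ := hW.exists_cancel hs hφ (a ∘ₗ θ) b hθ
    have hb : b ∘ₗ (φ ∘ₗ a ∘ₗ θ) = LinearMap.id := hθ
    obtain ⟨⟨eX⟩, ⟨eY⟩⟩ := hW.nonempty_equiv hs''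
      (hX'.of_leftInverse b.ker.subtype (kerProj _ b hb) (kerProj_subtype _ b hb))
      (hY.of_equiv e) hι' hs' hX hY' hι
    exact .inr ⟨⟨splitEquiv _ b hb ≪≫ₗ (LinearEquiv.refl R W).prodCongr eX⟩, ⟨e.symm ≪≫ₗ eY⟩⟩

end IsDualizing

omit [IsLocalRing R] [IsNoetherianRing R] in
/-- The approximation of `R / J` built from an approximation of `I / J`. -/
lemma isSES_coprod {W X K L : Type} [AddCommGroup W] [Module R W] [AddCommGroup X] [Module R X]
    [AddCommGroup K] [Module R K] [AddCommGroup L] [Module R L] {ι : Y →ₗ[R] X} {π : X →ₗ[R] K}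
    (hs : IsSES ι π) {i : W →ₗ[R] M} {q : W →ₗ[R] K} {j : K →ₗ[R] L} {p : M →ₗ[R] L}
    (hi : Function.Injective i) (hq : Function.Surjective q) (hj : Function.Injective j)
    (hp : Function.Surjective p) (hpi : p.ker ≤ i.range) (hc : j ∘ₗ q = p ∘ₗ i)
    (β : W →ₗ[R] X) (hβ : π ∘ₗ β = -q) :
    IsSES ((i ∘ₗ LinearMap.fst R W Y).prod (β.coprod ι)) (p.coprod (j ∘ₗ π)) := by
  have hc : ∀ w, j (q w) = p (i w) := LinearMap.congr_fun hc
  have hβ : ∀ w, π (β w) = -q w := LinearMap.congr_fun hβ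
  have hιπ : ∀ y, π (ι y) = 0 := hs.exact.apply_apply_eq_zero
  refine ⟨?_, fun l => ?_, fun ⟨r, x⟩ => ⟨fun h => ?_, ?_⟩⟩
  · rw [injective_iff_map_eq_zero]
    rintro ⟨w, y⟩ h
    obtain ⟨h1, h2⟩ := Prod.ext_iff.mp h
    obtain rfl : w = 0 := hi (h1.trans (map_zero i).symm)
    obtain rfl : y = 0 := hs.inj ((by simpa using h2 : ι y = 0).trans (map_zero ι).symm)
    rfl
  · obtain ⟨r, rfl⟩ := hp l
    exact ⟨(r, 0), by simp⟩
  · have h : p r + j (π x) = 0 := h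
    obtain ⟨w', hw'⟩ := hq (π x)
    rw [← hw', hc, ← map_add] at h
    obtain ⟨w, hw⟩ := hpi h
    obtain ⟨w, rfl⟩ : ∃ w, i w = r := ⟨w - w', by rw [map_sub, hw, add_sub_cancel_right]⟩
    rw [map_add, ← hc, ← hc, ← map_add] at h
    have hx : q w + q w' = 0 := hj (h.trans (map_zero j).symm)
    obtain ⟨y, hy⟩ := (hs.exact (x - β w)).mp (by
      rw [map_sub, hβ, ← hw', sub_neg_eq_add, add_comm, hx])
    exact ⟨(w, y), Prod.ext rfl (by simp [hy])⟩
  · rintro ⟨⟨w, y⟩, h⟩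
    rw [← h]
    simp [hβ, hιπ, hc]

section Translation

omit [IsNoetherianRing R]

lemma DepthGE.of_le_moduleDepth {X : ModuleCat R} {d : ℕ} (h : (d : ℕ∞) ≤ moduleDepth R X) :
    DepthGE R d X := by
  intro i hi
  by_contra hn
  rw [not_subsingleton_iff_nontrivial] at hn
  have hle : moduleDepth R X ≤ i :=
    sInf_le ⟨i, rfl, (modExtEquiv i (ModuleCat.of R (ResidueField R)) X).toEquiv.nontrivial⟩
  exact absurd (h.trans hle) (by exact_mod_cast hi.not_ge)

lemma nontrivial_of_moduleDepth_eq {X : ModuleCat R} {d : ℕ} (h : moduleDepth R X = d) :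
    Nontrivial (ExtOf R (ResidueField R) X d) := by
  have hne : {n : ℕ∞ | ∃ m : ℕ, n = (m : ℕ∞) ∧
      Nontrivial (ModExt R m (ModuleCat.of R (ResidueField R)) X)}.Nonempty := by
    rw [Set.nonempty_iff_ne_empty]
    intro h0
    rw [moduleDepth, h0, sInf_empty] at h
    exact ENat.top_ne_natCast d h
  obtain ⟨m, hm, hn⟩ := csInf_mem hne
  obtain rfl : d = m := by exact_mod_cast h.symm.trans hm
  exact (modExtEquiv d (ModuleCat.of R (ResidueField R)) X).symm.toEquiv.nontrivial

omit [IsLocalRing R] in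
lemma exists_extVanish_of_hasFiniteInjDim {Y : ModuleCat R} (h : HasFiniteInjDim R Y) :
    ∃ r, ExtVanish R r Y := by
  obtain ⟨n, hn⟩ := h
  refine ⟨n + 1, fun N _ _ _ i hi => ?_⟩
  have := hn (ModuleCat.of R N) i hi
  exact (modExtEquiv i (ModuleCat.of R N) Y).symm.toEquiv.subsingleton

lemma moduleDepth_eq {X : ModuleCat R} {d : ℕ} (hd : ringKrullDim R = d)
    (h : (moduleDepth R X : WithBot ℕ∞) = ringKrullDim R) : moduleDepth R X = d := by
  rw [hd] at h
  exact_mod_cast h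

lemma isSimpleModule_residueField : IsSimpleModule R (ResidueField R) :=
  isSimpleModule_iff_quot_maximal.mpr
    ⟨maximalIdeal R, inferInstance, ⟨LinearEquiv.refl R (ResidueField R)⟩⟩

end Translation

lemma exists_extVanish_succ {Y : ModuleCat R} [Module.Finite R Y] {d : ℕ}
    (hd : ringKrullDim R = d)
    (hR : (moduleDepth R (ModuleCat.of R R) : WithBot ℕ∞) = ringKrullDim R)
    (hY : HasFiniteInjDim R Y) : ExtVanish R (d + 1) Y := by
  obtain ⟨r, hr⟩ := exists_extVanish_of_hasFiniteInjDim hY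
  have hR := moduleDepth_eq hd hR
  exact hr.of_le_depth (DepthGE.of_le_moduleDepth (X := ModuleCat.of R R) hR.ge)
    (nontrivial_of_moduleDepth_eq (X := ModuleCat.of R R) hR)

end Local

end depth

theorem stmt9 (R : Type) [CommRing R] [IsLocalRing R]
    (hCM : IsCMLocalRing R) (hGG : IsGenericallyGorenstein R)
    (ω : Ideal R) (hω : IsCanonicalIdeal R ω)
    (Y₁ X₁ : ModuleCat R) (ι₁ : Y₁ →ₗ[R] X₁) (π₁ : X₁ →ₗ[R] qmod R ω (ω ^ 2))
    (h₁ : IsMinMCMApprox R (qmod R ω (ω ^ 2)) Y₁ X₁ ι₁ π₁)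
    (Y₂ X₂ : ModuleCat R) (ι₂ : Y₂ →ₗ[R] X₂) (π₂ : X₂ →ₗ[R] ModuleCat.of R (R ⧸ ω ^ 2))
    (h₂ : IsMinMCMApprox R (ModuleCat.of R (R ⧸ ω ^ 2)) Y₂ X₂ ι₂ π₂) :
    ((Nonempty ((R × X₁) ≃ₗ[R] X₂) ∧ Nonempty ((↥ω × Y₁) ≃ₗ[R] Y₂)) ∨ (Nonempty ((R × X₁) ≃ₗ[R] (↥ω × X₂)) ∧ Nonempty (Y₁ ≃ₗ[R] Y₂))) ∧ ¬ ((Nonempty ((R × X₁) ≃ₗ[R] X₂) ∧ Nonempty ((↥ω × Y₁) ≃ₗ[R] Y₂)) ∧ (Nonempty ((R × X₁) ≃ₗ[R] (↥ω × X₂)) ∧ Nonempty (Y₁ ≃ₗ[R] Y₂))) := by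
  have := hCM.1
  obtain ⟨hωfin, hωinj, d, hd, ⟨hk⟩, hvan⟩ := hω
  have hωfin' : Module.Finite R ω := hωfin
  have hW : IsDualizing R d ω :=
    { dim := hd
      vanish := exists_extVanish_succ (Y := ModuleCat.of R ω) hd hCM.2 hωinj
      depth := fun i hi => by
        have := hvan i hi.ne
        exact (modExtEquiv i (ModuleCat.of R (IsLocalRing.ResidueField R))
          (ModuleCat.of R ω)).symm.toEquiv.subsingleton
      simple :=
        have := isSimpleModule_residueField (R := R)
        IsSimpleModule.congr ((modExtEquiv d (ModuleCat.of R (IsLocalRing.ResidueField R))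
          (ModuleCat.of R ω)).symm.trans hk) }
  obtain ⟨⟨-, hY₁, ⟨hX₁, hX₁d⟩, hY₁i, hι₁, hπ₁, hex₁⟩, hmin₁⟩ := h₁
  obtain ⟨⟨-, hY₂, ⟨hX₂, hX₂d⟩, hY₂i, hι₂, hπ₂, hex₂⟩, hmin₂⟩ := h₂
  have hs₁ : IsSES ι₁ π₁ := ⟨hι₁, hπ₁, hex₁⟩
  have hs₂ : IsSES ι₂ π₂ := ⟨hι₂, hπ₂, hex₂⟩
  have hR : DepthGE R d R :=
    DepthGE.of_le_moduleDepth (X := ModuleCat.of R R) (moduleDepth_eq hd hCM.2).ge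
  have hD₁ : DepthGE R d X₁ := DepthGE.of_le_moduleDepth (moduleDepth_eq hd hX₁d).ge
  have hD₂ : DepthGE R d X₂ := DepthGE.of_le_moduleDepth (moduleDepth_eq hd hX₂d).ge
  have hO₁ : IsExtOrthogonal R d Y₁ := (exists_extVanish_succ hd hCM.2 hY₁i).isExtOrthogonal
  have hO₂ : IsExtOrthogonal R d Y₂ := (exists_extVanish_succ hd hCM.2 hY₂i).isExtOrthogonal
  refine ⟨?_, ?_⟩
  · let q : ω →ₗ[R] ω ⧸ Submodule.comap ω.subtype (ω ^ 2) := Submodule.mkQ _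
    obtain ⟨β, hβ⟩ := hs₁.exists_lift (hO₁ ω hW.depth) (-q)
    let j : (ω ⧸ Submodule.comap ω.subtype (ω ^ 2)) →ₗ[R] R ⧸ ω ^ 2 :=
      Submodule.mapQ _ _ ω.subtype le_rfl
    have hs := isSES_coprod hs₁ (i := ω.subtype) (q := q) (j := j) (p := Submodule.mkQ (ω ^ 2))
      ω.subtype_injective (Submodule.mkQ_surjective _)
      (by
        rw [injective_iff_map_eq_zero]
        intro v hv
        obtain ⟨w, rfl⟩ := Submodule.Quotient.mk_surjective _ v
        exact (Submodule.Quotient.mk_eq_zero _).mpr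
          ((Submodule.Quotient.mk_eq_zero (ω ^ 2) (x := (w : R))).mp hv))
      (Submodule.mkQ_surjective _)
      (by
        rw [Submodule.ker_mkQ, Submodule.range_subtype]
        exact Ideal.pow_le_self two_ne_zero)
      rfl β hβ
    refine hW.dichotomy hs (hR.prod hD₁) hO₁ (fun a b => ?_) hs₂ hD₂ hO₂ (hW.isTopRadical hmin₂)
    rw [← hW.isTopRadical hmin₁ a (b ∘ₗ LinearMap.inr R R X₁)]
    congr 1
    ext w
    simp
  · rintro ⟨⟨-, ⟨e⟩⟩, -, ⟨e'⟩⟩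
    have hinj := (OrzechProperty.bijective_of_surjective_endomorphism
      (LinearMap.snd R ω Y₁ ∘ₗ (e'.trans e.symm).toLinearMap)
      ((LinearMap.snd_surjective (R := R) (M := ω) (M₂ := Y₁)).comp (e'.trans e.symm).surjective)).1
    have := hW.nontrivial
    obtain ⟨w, hw⟩ := exists_ne (0 : ω)
    refine hw (congrArg Prod.fst ((e'.trans e.symm).symm.injective (hinj ?_) :
      ((w, 0) : ω × Y₁) = 0))
    simp

end
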